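/- Let σ and μ be absolutely continuous probability measures on ℝⁿ with finite second moments and let P ∈ O(n). Then the pushforward measure (T_{σ,μ;P})_♯σ is absolutely continuous with respect to the Lebesgue measure on ℝⁿ and has finite second moment. -/

import Mathlib

open MeasureTheory Filter
open scoped ENNReal RealInnerProductSpace BigOperators Topology

noncomputable section

namespace SliceMatching

/-- `ℝⁿ` with its Euclidean structure. -/
abbrev Rn (n : ℕ) := EuclideanSpace ℝ (Fin n)

/-- The cumulative distribution function of a measure on `ℝ`. -/
def cdf (ν : Measure ℝ) (t : ℝ) : ℝ := (ν (Set.Iic t)).toReal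

/-- The quantile function (pseudo-inverse of the CDF) of a measure on `ℝ`. -/
def quantile (ρ : Measure ℝ) (p : ℝ) : ℝ := sInf {t : ℝ | p ≤ cdf ρ t}

/-- The one-dimensional optimal transport map `T_ν^ρ = F_ρ⁻¹ ∘ F_ν`. -/
def otMap1d (ν ρ : Measure ℝ) (t : ℝ) : ℝ := quantile ρ (cdf ν t)

/-- The slice `σ^θ`: pushforward of `σ` under the projection `x ↦ ⟪x, θ⟫`. -/
def slice {n : ℕ} (σ : Measure (Rn n)) (θ : Rn n) : Measure ℝ :=
  σ.map (fun x => ⟪x, θ⟫)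

/-- The matrix-slice matching map `T_{σ,μ;P}`, where `P ∈ O(n)` has columns `θ 0, …, θ (n-1)`:
`T_{σ,μ;P}(x) = ∑ i, T_{σ^{θ i}}^{μ^{θ i}}(⟪x, θ i⟫) • θ i`. -/
def smMap {n : ℕ} (σ μ : Measure (Rn n)) (θ : Fin n → Rn n) (x : Rn n) : Rn n :=
  ∑ i, otMap1d (slice σ (θ i)) (slice μ (θ i)) ⟪x, θ i⟫ • θ i

/-- The squared quadratic Wasserstein distance: the infimum of `∫ ‖x - y‖²` over all
couplings of `σ` and `μ`. -/
def W2sq {α : Type*} [MeasurableSpace α] [NormedAddCommGroup α] (σ μ : Measure α) : ℝ :=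
  (⨅ (π : Measure (α × α)) (_ : π.map Prod.fst = σ ∧ π.map Prod.snd = μ),
    ∫⁻ p, ENNReal.ofReal (‖p.1 - p.2‖ ^ 2) ∂π).toReal

/-- The quadratic Wasserstein distance `W₂`. -/
def W2 {α : Type*} [MeasurableSpace α] [NormedAddCommGroup α] (σ μ : Measure α) : ℝ :=
  Real.sqrt (W2sq σ μ)

theorem pi_absolutelyContinuous {n : ℕ} {X : Fin n → Type*} [∀ i, MeasurableSpace (X i)]
    {α β : ∀ i, Measure (X i)} [∀ i, SigmaFinite (α i)] [∀ i, SigmaFinite (β i)]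
    (h : ∀ i, α i ≪ β i) : Measure.pi α ≪ Measure.pi β := by
  induction n with
  | zero => rw [Measure.pi_of_empty α, Measure.pi_of_empty β]
  | succ n ih =>
    have hα := (measurePreserving_piFinSuccAbove α 0).symm
    have hβ := (measurePreserving_piFinSuccAbove β 0).symm
    rw [← hα.map_eq, ← hβ.map_eq]
    exact ((h 0).prod (ih fun j => h _)).map (MeasurableEquiv.measurable _)

/-- An absolutely continuous measure on `ℝⁿ` is absolutely continuous with respect to the product
of its marginals. -/
theorem absolutelyContinuous_pi_marginals {n : ℕ} (τ : Measure (Fin n → ℝ))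
    [IsProbabilityMeasure τ] (hτ : τ ≪ volume) :
    τ ≪ Measure.pi fun i => τ.map (Function.eval i) := by
  have hprob : ∀ i, IsProbabilityMeasure (τ.map (Function.eval i)) := fun i =>
    Measure.isProbabilityMeasure_map (measurable_pi_apply i).aemeasurable
  have hac : ∀ i, τ.map (Function.eval i) ≪ volume := fun i =>
    (hτ.map (measurable_pi_apply i)).trans
      (Measure.quasiMeasurePreserving_eval (fun _ : Fin n => (volume : Measure ℝ))
        i).absolutelyContinuous
  set f : Fin n → ℝ → ℝ≥0∞ := fun i => (τ.map (Function.eval i)).rnDeriv volume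
  have hf : ∀ i, Measurable (f i) := fun i => Measure.measurable_rnDeriv _ _
  have hrestrict : ∀ i, volume.restrict {x | f i x ≠ 0} ≪ τ.map (Function.eval i) := by
    intro i
    refine Measure.AbsolutelyContinuous.mk fun s hs h0 => ?_
    rw [← Measure.withDensity_rnDeriv_eq _ _ (hac i), withDensity_apply_eq_zero (hf i)] at h0
    rwa [Measure.restrict_apply hs, Set.inter_comm]
  have hpi := pi_absolutelyContinuous hrestrict
  rw [← Measure.restrict_pi_pi] at hpi
  refine Measure.AbsolutelyContinuous.trans ?_ hpi
  have hmem : ∀ᵐ x ∂τ, x ∈ Set.univ.pi fun i => {x | f i x ≠ 0} := by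
    simp only [Set.mem_univ_pi, ae_all_iff]
    intro i
    have h := Measure.rnDeriv_pos (hac i)
    filter_upwards [ae_of_ae_map (measurable_pi_apply i).aemeasurable h] with x hx
    exact hx.ne'
  rw [← Measure.restrict_eq_self_of_ae_mem hmem]
  exact hτ.restrict _

theorem cdf_eq (ν : Measure ℝ) [IsProbabilityMeasure ν] : cdf ν = ProbabilityTheory.cdf ν := by
  ext t
  rw [ProbabilityTheory.cdf_eq_real]
  rfl

theorem monotone_cdf (ν : Measure ℝ) [IsProbabilityMeasure ν] : Monotone (cdf ν) := by
  rw [cdf_eq]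
  exact ProbabilityTheory.monotone_cdf ν

theorem tendsto_cdf_atBot (ν : Measure ℝ) [IsProbabilityMeasure ν] :
    Tendsto (cdf ν) atBot (𝓝 0) := by
  rw [cdf_eq]
  exact ProbabilityTheory.tendsto_cdf_atBot ν

theorem tendsto_cdf_atTop (ν : Measure ℝ) [IsProbabilityMeasure ν] :
    Tendsto (cdf ν) atTop (𝓝 1) := by
  rw [cdf_eq]
  exact ProbabilityTheory.tendsto_cdf_atTop ν

theorem continuous_cdf (ν : Measure ℝ) [IsProbabilityMeasure ν] [NullSingletonClass ν] :
    Continuous (cdf ν) := by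
  rw [cdf_eq, continuous_iff_continuousAt]
  intro x
  have h : (ProbabilityTheory.cdf ν).measure {x} = 0 := by
    rw [ProbabilityTheory.measure_cdf, measure_singleton]
  rw [StieltjesFunction.measure_singleton, ENNReal.ofReal_eq_zero, sub_nonpos] at h
  rw [(ProbabilityTheory.cdf ν).mono.continuousAt_iff_leftLim_eq_rightLim,
    StieltjesFunction.rightLim_eq]
  exact le_antisymm ((ProbabilityTheory.cdf ν).mono.leftLim_le le_rfl) h

theorem quantile_le_iff (ρ : Measure ℝ) [IsProbabilityMeasure ρ] {p : ℝ} (hp0 : 0 < p)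
    (hp1 : p < 1) (t : ℝ) : quantile ρ p ≤ t ↔ p ≤ cdf ρ t := by
  have hbdd : BddBelow {t : ℝ | p ≤ cdf ρ t} := by
    obtain ⟨a, ha⟩ := ((tendsto_cdf_atBot ρ).eventually (gt_mem_nhds hp0)).exists
    refine ⟨a, fun t ht => ?_⟩
    by_contra! hta
    exact absurd (lt_of_le_of_lt (le_trans ht (monotone_cdf ρ hta.le)) ha) (lt_irrefl p)
  have hne : {t : ℝ | p ≤ cdf ρ t}.Nonempty := by
    obtain ⟨b, hb⟩ := ((tendsto_cdf_atTop ρ).eventually (lt_mem_nhds hp1)).exists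
    exact ⟨b, hb.le⟩
  refine ⟨fun h => ?_, fun h => csInf_le hbdd h⟩
  have hright : Tendsto (cdf ρ) (𝓝[>] t) (𝓝 (cdf ρ t)) := by
    rw [cdf_eq]
    exact ((ProbabilityTheory.cdf ρ).right_continuous t).mono_left
      (nhdsWithin_mono _ Set.Ioi_subset_Ici_self)
  refine ge_of_tendsto hright ?_
  filter_upwards [self_mem_nhdsWithin] with s hs
  obtain ⟨u, hu, hus⟩ := exists_lt_of_csInf_lt hne (lt_of_le_of_lt h hs)
  exact le_trans hu (monotone_cdf ρ hus.le)

theorem quantile_of_nonpos (ρ : Measure ℝ) {p : ℝ} (hp : p ≤ 0) : quantile ρ p = 0 := by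
  have : {t : ℝ | p ≤ cdf ρ t} = Set.univ :=
    Set.eq_univ_of_forall fun t => hp.trans ENNReal.toReal_nonneg
  rw [quantile, this, Real.sInf_univ]

theorem quantile_of_one_lt (ρ : Measure ℝ) [IsProbabilityMeasure ρ] {p : ℝ} (hp : 1 < p) :
    quantile ρ p = 0 := by
  have : {t : ℝ | p ≤ cdf ρ t} = ∅ :=
    Set.eq_empty_of_forall_notMem fun t ht => by
      have : cdf ρ t ≤ 1 := measureReal_le_one
      exact absurd (le_trans ht this) (not_le.2 hp)
  rw [quantile, this, Real.sInf_empty]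

theorem measurable_quantile (ρ : Measure ℝ) [IsProbabilityMeasure ρ] :
    Measurable (quantile ρ) := by
  refine measurable_of_Iic fun t => ?_
  have : quantile ρ ⁻¹' Set.Iic t = (Set.Ioo 0 1 ∩ Set.Iic (cdf ρ t)) ∪
      ({p | p = 1 ∧ quantile ρ 1 ≤ t} ∪ ((Set.Iic 0 ∪ Set.Ioi 1) ∩ {_p | 0 ≤ t})) := by
    ext p
    simp only [Set.mem_preimage, Set.mem_Iic, Set.mem_union, Set.mem_inter_iff, Set.mem_Ioo,
      Set.mem_ofPred_eq, Set.mem_Ioi]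
    rcases le_or_gt p 0 with h0 | h0
    · rw [quantile_of_nonpos ρ h0]
      grind
    rcases lt_trichotomy p 1 with h1 | h1 | h1
    · rw [quantile_le_iff ρ h0 h1]
      grind
    · subst h1
      grind
    · rw [quantile_of_one_lt ρ h1]
      grind
  rw [this]
  refine (measurableSet_Ioo.inter measurableSet_Iic).union (.union ?_ ?_)
  · exact (measurableSet_singleton 1).inter (.const _)
  · exact (measurableSet_Iic.union measurableSet_Ioi).inter (.const _)

theorem measurable_otMap1d (ν ρ : Measure ℝ) [IsProbabilityMeasure ν] [IsProbabilityMeasure ρ] :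
    Measurable (otMap1d ν ρ) :=
  (measurable_quantile ρ).comp (monotone_cdf ν).measurable

/-- The probability integral transform: the CDF of an atomless law is uniformly distributed. -/
theorem measureReal_cdf_le (ν : Measure ℝ) [IsProbabilityMeasure ν] [NullSingletonClass ν] {p : ℝ}
    (hp0 : 0 ≤ p) (hp1 : p < 1) : ν.real {t | cdf ν t ≤ p} = p := by
  rcases Set.eq_empty_or_nonempty {t | cdf ν t ≤ p} with he | ⟨a, ha⟩
  · rw [he, measureReal_empty]
    refine le_antisymm hp0 (ge_of_tendsto' (tendsto_cdf_atBot ν) fun t => ?_)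
    by_contra! h
    exact (he ▸ h.le : t ∈ (∅ : Set ℝ))
  obtain ⟨b, hb⟩ := ((tendsto_cdf_atTop ν).eventually (lt_mem_nhds hp1)).exists
  have hbdd : BddAbove {t | cdf ν t ≤ p} := by
    refine ⟨b, fun t ht => ?_⟩
    by_contra! h
    exact absurd (lt_of_lt_of_le hb ((monotone_cdf ν h.le).trans ht)) (lt_irrefl p)
  have hclosed : IsClosed {t | cdf ν t ≤ p} := isClosed_le (continuous_cdf ν) continuous_const
  have hc : cdf ν (sSup {t | cdf ν t ≤ p}) ≤ p := hclosed.csSup_mem ⟨a, ha⟩ hbdd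
  have hset : {t | cdf ν t ≤ p} = Set.Iic (sSup {t | cdf ν t ≤ p}) := by
    ext t
    exact ⟨fun ht => le_csSup hbdd ht, fun ht => (monotone_cdf ν ht).trans hc⟩
  obtain ⟨c, hcp⟩ : ∃ c, cdf ν c = p :=
    mem_range_of_exists_le_of_exists_ge (continuous_cdf ν) ⟨a, ha⟩ ⟨b, hb.le⟩
  have hle : p ≤ cdf ν (sSup {t | cdf ν t ≤ p}) :=
    hcp.symm.le.trans (monotone_cdf ν (le_csSup hbdd hcp.le))
  calc ν.real {t | cdf ν t ≤ p} = cdf ν (sSup {t | cdf ν t ≤ p}) := by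
        conv_lhs => rw [hset]
        rfl
    _ = p := le_antisymm hc hle

theorem ae_cdf_mem_Ioo (ν : Measure ℝ) [IsProbabilityMeasure ν] [NullSingletonClass ν] :
    ∀ᵐ t ∂ν, 0 < cdf ν t ∧ cdf ν t < 1 := by
  refine .and ?_ ?_
  · have h := measureReal_cdf_le ν le_rfl one_pos
    rw [measureReal_eq_zero_iff] at h
    simpa [ae_iff] using h
  · simp only [ae_iff, not_lt]
    rw [← measureReal_eq_zero_iff]
    refine le_antisymm (le_of_forall_pos_le_add fun ε hε => ?_) measureReal_nonneg
    have hp1 : max 0 (1 - ε) < 1 := max_lt one_pos (by linarith)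
    have hm : MeasurableSet {t | cdf ν t ≤ max 0 (1 - ε)} :=
      measurableSet_le (monotone_cdf ν).measurable measurable_const
    have hsub : {t | 1 ≤ cdf ν t} ⊆ {t | cdf ν t ≤ max 0 (1 - ε)}ᶜ := fun t ht =>
      not_le.2 (hp1.trans_le ht)
    have h := measureReal_mono (μ := ν) hsub
    rw [probReal_compl_eq_one_sub hm, measureReal_cdf_le ν (le_max_left _ _) hp1] at h
    linarith [le_max_right 0 (1 - ε)]

theorem map_otMap1d (ν ρ : Measure ℝ) [IsProbabilityMeasure ν] [IsProbabilityMeasure ρ]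
    [NullSingletonClass ν] : ν.map (otMap1d ν ρ) = ρ := by
  have := Measure.isProbabilityMeasure_map (μ := ν) (measurable_otMap1d ν ρ).aemeasurable
  refine Measure.ext_of_Iic _ _ fun t => ?_
  rw [Measure.map_apply (measurable_otMap1d ν ρ) measurableSet_Iic]
  have hae : otMap1d ν ρ ⁻¹' Set.Iic t =ᵐ[ν] {s | cdf ν s ≤ cdf ρ t} := by
    filter_upwards [ae_cdf_mem_Ioo ν] with s hs
    exact propext (quantile_le_iff ρ hs.1 hs.2 t)
  rw [measure_congr hae, ← measureReal_eq_measureReal_iff]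
  change _ = cdf ρ t
  have hle : cdf ρ t ≤ 1 := measureReal_le_one
  rcases hle.lt_or_eq with h | h
  · exact measureReal_cdf_le ν ENNReal.toReal_nonneg h
  · have huniv : {s | cdf ν s ≤ cdf ρ t} = Set.univ :=
      Set.eq_univ_of_forall fun s => by
        rw [Set.mem_ofPred_eq, h]
        exact measureReal_le_one
    rw [huniv, probReal_univ, h]

theorem isProbabilityMeasure_slice {n : ℕ} (σ : Measure (Rn n)) [IsProbabilityMeasure σ]
    (θ : Rn n) : IsProbabilityMeasure (slice σ θ) :=
  Measure.isProbabilityMeasure_map (by fun_prop)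

/-- Coordinates of `ℝⁿ` with respect to an orthonormal basis. -/
def coords {n : ℕ} (b : OrthonormalBasis (Fin n) ℝ (Rn n)) : Rn n ≃ᵐ (Fin n → ℝ) :=
  b.measurableEquiv.trans (MeasurableEquiv.toLp 2 (Fin n → ℝ)).symm

theorem coords_apply {n : ℕ} (b : OrthonormalBasis (Fin n) ℝ (Rn n)) (x : Rn n) (i : Fin n) :
    coords b x i = ⟪x, b i⟫ := by
  rw [real_inner_comm, ← b.repr_apply_apply]
  rfl

theorem measurePreserving_coords {n : ℕ} (b : OrthonormalBasis (Fin n) ℝ (Rn n)) :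
    MeasurePreserving (coords b) :=
  b.measurePreserving_measurableEquiv.trans
    (EuclideanSpace.volume_preserving_symm_measurableEquiv_toLp (Fin n))

theorem coords_smMap {n : ℕ} (σ μ : Measure (Rn n)) (b : OrthonormalBasis (Fin n) ℝ (Rn n))
    (x : Rn n) (i : Fin n) :
    coords b (smMap σ μ b x) i = otMap1d (slice σ (b i)) (slice μ (b i)) (coords b x i) := by
  rw [coords_apply, coords_apply, smMap, b.orthonormal.inner_left_fintype]
  simp

theorem map_eval_map_coords {n : ℕ} (σ : Measure (Rn n)) (b : OrthonormalBasis (Fin n) ℝ (Rn n))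
    (i : Fin n) : (σ.map (coords b)).map (Function.eval i) = slice σ (b i) := by
  rw [Measure.map_map (measurable_pi_apply i) (coords b).measurable, slice]
  congr 1
  ext x
  exact coords_apply b x i

theorem slice_absolutelyContinuous {n : ℕ} {σ : Measure (Rn n)} (hσ : σ ≪ volume)
    (b : OrthonormalBasis (Fin n) ℝ (Rn n)) (i : Fin n) : slice σ (b i) ≪ volume := by
  rw [← map_eval_map_coords]
  have h := hσ.map (coords b).measurable
  rw [(measurePreserving_coords b).map_eq] at h
  exact (h.map (measurable_pi_apply i)).trans
    (Measure.quasiMeasurePreserving_eval (fun _ : Fin n => (volume : Measure ℝ))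
      i).absolutelyContinuous

theorem nullSingletonClass_slice {n : ℕ} {σ : Measure (Rn n)} (hσ : σ ≪ volume)
    (b : OrthonormalBasis (Fin n) ℝ (Rn n)) (i : Fin n) : NullSingletonClass (slice σ (b i)) :=
  ⟨fun _ => slice_absolutelyContinuous hσ b i (measure_singleton _)⟩

theorem measurable_smMap {n : ℕ} (σ μ : Measure (Rn n)) [IsProbabilityMeasure σ]
    [IsProbabilityMeasure μ] (θ : Fin n → Rn n) : Measurable (smMap σ μ θ) := by
  have := fun i => isProbabilityMeasure_slice σ (θ i)
  have := fun i => isProbabilityMeasure_slice μ (θ i)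
  refine Finset.measurable_sum _ fun i _ => ?_
  exact ((measurable_otMap1d _ _).comp (by fun_prop)).smul_const (θ i)

theorem map_smMap_absolutelyContinuous {n : ℕ} (σ μ : Measure (Rn n)) [IsProbabilityMeasure σ]
    [IsProbabilityMeasure μ] (hσ : σ ≪ volume) (hμ : μ ≪ volume)
    (b : OrthonormalBasis (Fin n) ℝ (Rn n)) : σ.map (smMap σ μ b) ≪ volume := by
  have hpσ := fun i => isProbabilityMeasure_slice σ (b i)
  have hpμ := fun i => isProbabilityMeasure_slice μ (b i)
  have hna := nullSingletonClass_slice hσ b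
  set T : ∀ _ : Fin n, ℝ → ℝ := fun i => otMap1d (slice σ (b i)) (slice μ (b i)) with hT
  have hTm : ∀ i, Measurable (T i) := fun i => measurable_otMap1d _ _
  have hpush : ∀ i, (slice σ (b i)).map (T i) = slice μ (b i) := fun i => map_otMap1d _ _
  have hD : Measurable fun (x : Fin n → ℝ) i => T i (x i) := by fun_prop
  have hτprob : IsProbabilityMeasure (σ.map (coords b)) :=
    Measure.isProbabilityMeasure_map (coords b).measurable.aemeasurable
  have hτ : σ.map (coords b) ≪ volume := by
    rw [← (measurePreserving_coords b).map_eq]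
    exact hσ.map (coords b).measurable
  have h := (absolutelyContinuous_pi_marginals _ hτ).map hD
  simp only [map_eval_map_coords] at h
  have hprob : ∀ i, SigmaFinite ((slice σ (b i)).map (T i)) := fun i => by
    rw [hpush i]; infer_instance
  rw [Measure.pi_map_pi fun i => (hTm i).aemeasurable] at h
  simp only [hpush] at h
  have h' := (h.trans (pi_absolutelyContinuous fun i =>
    slice_absolutelyContinuous hμ b i)).map (coords b).symm.measurable
  rw [← volume_pi, (measurePreserving_coords b).symm.map_eq,
    Measure.map_map hD (coords b).measurable,
    Measure.map_map (coords b).symm.measurable (hD.comp (coords b).measurable)] at h'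
  convert h' using 2
  ext1 x
  refine (coords b).injective ?_
  ext i
  simp [coords_smMap, hT]

theorem integrable_norm_sq_map_smMap {n : ℕ} (σ μ : Measure (Rn n)) [IsProbabilityMeasure σ]
    [IsProbabilityMeasure μ] (hσ : σ ≪ volume) (hμ2 : Integrable (fun y => ‖y‖ ^ 2) μ)
    (b : OrthonormalBasis (Fin n) ℝ (Rn n)) :
    Integrable (fun x => ‖x‖ ^ 2) (σ.map (smMap σ μ b)) := by
  have hpσ := fun i => isProbabilityMeasure_slice σ (b i)
  have hpμ := fun i => isProbabilityMeasure_slice μ (b i)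
  have hna := nullSingletonClass_slice hσ b
  rw [integrable_map_measure (by fun_prop) (measurable_smMap σ μ b).aemeasurable]
  have hsum : (fun x : Rn n => ‖x‖ ^ 2) ∘ smMap σ μ b = fun x =>
      ∑ i, otMap1d (slice σ (b i)) (slice μ (b i)) ⟪x, b i⟫ ^ 2 := by
    ext x
    rw [Function.comp_apply, ← b.sum_sq_norm_inner_left]
    refine Finset.sum_congr rfl fun i _ => ?_
    rw [Real.norm_eq_abs, sq_abs, ← coords_apply, coords_smMap, coords_apply]
  rw [hsum]
  refine integrable_finsetSum _ fun i _ => ?_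
  have hμi : Integrable (fun y : ℝ => y ^ 2) (slice μ (b i)) := by
    rw [slice, integrable_map_measure (by fun_prop) (by fun_prop)]
    refine hμ2.mono' (by fun_prop) (.of_forall fun y => ?_)
    rw [Function.comp_apply, norm_pow]
    gcongr
    simpa using norm_inner_le_norm (𝕜 := ℝ) y (b i)
  rw [← map_otMap1d (slice σ (b i)) (slice μ (b i)), integrable_map_measure (by fun_prop)
    (measurable_otMap1d _ _).aemeasurable] at hμi
  exact hμi.comp_aemeasurable (f := fun x : Rn n => ⟪x, b i⟫) (by fun_prop)

/-- If `σ` and `μ` are absolutely continuous with finite second moments,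
then `(T_{σ,μ;P})_♯σ` is absolutely continuous and has finite second moment. -/
theorem stmt19 {n : ℕ}
    (σ μ : Measure (Rn n)) [IsProbabilityMeasure σ] [IsProbabilityMeasure μ]
    (hσac : σ ≪ volume) (hμac : μ ≪ volume)
    (hσ2 : Integrable (fun x => ‖x‖ ^ 2) σ) (hμ2 : Integrable (fun y => ‖y‖ ^ 2) μ)
    (θ : Fin n → Rn n) (hθ : Orthonormal ℝ θ) :
    σ.map (smMap σ μ θ) ≪ volume ∧
    Integrable (fun x => ‖x‖ ^ 2) (σ.map (smMap σ μ θ)) := by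
  have hspan : ⊤ ≤ Submodule.span ℝ (Set.range θ) :=
    (hθ.linearIndependent.span_eq_top_of_card_eq_finrank' (by simp)).ge
  have hb : ⇑(OrthonormalBasis.mk hθ hspan) = θ := OrthonormalBasis.coe_mk hθ hspan
  rw [← hb]
  exact ⟨map_smMap_absolutelyContinuous σ μ hσac hμac _,
    integrable_norm_sq_map_smMap σ μ hσac hμ2 _⟩

end SliceMatching
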